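/- Let τ = (T_1,…,T_s), η ∈ OP_n and suppose |η| ≥ 2. Then ∑_{h ∈ S_s} w(h(τ), η) = 0 and ∑_{h ∈ S_s} g(h(τ), η) = 0, where the sums run over all permutations h of [s] and h(τ) = (T_{h(1)},…,T_{h(s)}) denotes the ordered set partition obtained by permuting the blocks of τ. -/

import Mathlib

open Finset

namespace OSPpaper

/-- A *block* is a subset of `[n] = Fin n`. -/
abbrev Block (n : ℕ) := Finset (Fin n)

/-- `l` is an ordered set partition of the ground set `E ⊆ [n]`:
a finite sequence of pairwise disjoint nonempty subsets of `E` whose union is `E`. -/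
def IsOSP {n : ℕ} (E : Finset (Fin n)) (l : List (Block n)) : Prop :=
  (∀ P ∈ l, P.Nonempty) ∧ l.Pairwise (fun P Q => Disjoint P Q) ∧
    (∀ P ∈ l, P ⊆ E) ∧ ∀ i ∈ E, ∃ P ∈ l, i ∈ P

/-- Union of a list of blocks. -/
def unionList {n : ℕ} (l : List (Block n)) : Block n := l.foldr (· ∪ ·) ∅

/-- The order on ordered set partitions: `π ≤ σ` iff every block of `σ` is the union
of a contiguous run of blocks of `π` (runs taken in order). -/
def OSPle {n : ℕ} (π σ : List (Block n)) : Prop :=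
  ∃ L : List (List (Block n)), L.flatten = π ∧ σ = L.map unionList

/-- The restriction `σ⌋_P`: intersect every block with `P` and delete the empty intersections. -/
def restrict {n : ℕ} (σ : List (Block n)) (P : Block n) : List (Block n) :=
  (σ.map (fun Q => Q ∩ P)).filter (fun Q => decide (Q ≠ ∅))

/-- The quasi-meet `π ⋏ σ`: the concatenation `σ⌋_{P₁} σ⌋_{P₂} ⋯ σ⌋_{P_p}`. -/
def qmeet {n : ℕ} (π σ : List (Block n)) : List (Block n) :=
  (π.map (fun P => restrict σ P)).flatten

/-- Refinement: every block of `σ` is contained in some block of `τ`.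
(As a relation on the underlying unordered partitions, this is the refinement order;
in particular `refines τ η` says `τ̄ ≤ η̄`.) -/
def refines {n : ℕ} (σ τ : List (Block n)) : Prop := ∀ P ∈ σ, ∃ Q ∈ τ, P ⊆ Q

/-- An interval partition of `[m]`, with its blocks listed in (the unique) increasing order:
an ordered set partition whose consecutive blocks are completely ordered. -/
def IsIP {m : ℕ} (l : List (Finset (Fin m))) : Prop :=
  IsOSP Finset.univ l ∧ l.Chain' (fun P Q => ∀ a ∈ P, ∀ b ∈ Q, a < b)

/-- The (0-based) index `π(k)` of the block of `π` containing `k`. -/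
def blockIdx {n : ℕ} (π : List (Block n)) (k : Fin n) : ℕ :=
  π.findIdx (fun P => decide (k ∈ P))

/-- The ordered kernel `κ(i₁,…,iₙ)` of a tuple: the nonempty level sets of the tuple,
listed in increasing order of the value. -/
def kernel {n : ℕ} (i : Fin n → ℕ) : List (Block n) :=
  ((Finset.image i Finset.univ).sort (· ≤ ·)).map
    (fun v => Finset.univ.filter (fun k => i k = v))

/-- `[σ:π] = ∏_{P ∈ π} #(σ⌋_P)`. -/
def colonNum {n : ℕ} (σ π : List (Block n)) : ℕ :=
  (π.map (fun P => (restrict σ P).length)).prod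

/-- `[σ:π]! = ∏_{P ∈ π} #(σ⌋_P)!`. -/
def colonFac {n : ℕ} (σ π : List (Block n)) : ℕ :=
  (π.map (fun P => Nat.factorial (restrict σ P).length)).prod

/-- For `τ̄ ≤ η̄` the sequence `(m_1,…,m_s)`: `m_i` is the (0-based) index of the block of `η`
containing the `i`-th block of `τ`. -/
def mseq {n : ℕ} (τ η : List (Block n)) : List ℕ :=
  τ.map (fun T => η.findIdx (fun E => decide (T ⊆ E)))

/-- number of ascents of a sequence -/
def ascL (l : List ℕ) : ℕ := ((l.zip l.tail).filter (fun p => decide (p.1 < p.2))).length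
/-- number of descents of a sequence -/
def desL (l : List ℕ) : ℕ := ((l.zip l.tail).filter (fun p => decide (p.2 < p.1))).length
/-- number of plateaux of a sequence -/
def platL (l : List ℕ) : ℕ := ((l.zip l.tail).filter (fun p => decide (p.1 = p.2))).length

/-- `asc_η(τ)` -/
def ascN {n : ℕ} (τ η : List (Block n)) : ℕ := ascL (mseq τ η)
/-- `des_η(τ)` -/
def desN {n : ℕ} (τ η : List (Block n)) : ℕ := desL (mseq τ η)
/-- `plat_η(τ)` -/
def platN {n : ℕ} (τ η : List (Block n)) : ℕ := platL (mseq τ η)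

/-- lengths of the maximal ascending runs of a sequence -/
def ascRunLengths (l : List ℕ) : List ℕ :=
  (l.splitBy (fun a b => decide (a < b))).map List.length
/-- lengths of the maximal level (constant) runs of a sequence -/
def levelRunLengths (l : List ℕ) : List ℕ :=
  (l.splitBy (fun a b => decide (a = b))).map List.length

/-- `μ̃(σ,π) = (−1)^{|σ|−|π|} / [σ:π]` (real-valued). -/
noncomputable def muR {n : ℕ} (σ π : List (Block n)) : ℝ :=
  (-1 : ℝ) ^ (σ.length - π.length) / (colonNum σ π : ℝ)

/-- `ζ̃(σ,π) = 1 / [σ:π]!` (real-valued). -/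
noncomputable def zetaR {n : ℕ} (σ π : List (Block n)) : ℝ :=
  1 / (colonFac σ π : ℝ)

/-- The Weisner coefficient `w(τ,η) = ∑_{σ ⋏ η = τ} μ̃(σ, 1̂ₙ)`. -/
noncomputable def wcoef {n : ℕ} (τ η : List (Block n)) : ℝ :=
  ∑ᶠ σ ∈ {σ : List (Block n) | IsOSP Finset.univ σ ∧ qmeet σ η = τ},
    muR σ [(Finset.univ : Block n)]

/-- The Goldberg coefficient `g(τ,η) = ∑_{σ ≥ τ} ζ̃(τ,σ) w(σ,η)`. -/
noncomputable def gcoef {n : ℕ} (τ η : List (Block n)) : ℝ :=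
  ∑ᶠ σ ∈ {σ : List (Block n) | IsOSP Finset.univ σ ∧ OSPle τ σ}, zetaR τ σ * wcoef σ η


lemma coeff_one_descPochhammer (p : ℕ) :
    (descPochhammer ℝ p).coeff 1 / (p.factorial : ℝ) = (-1 : ℝ) ^ (p - 1) / (p : ℝ) := by
  cases p with
  | zero => simp [Polynomial.coeff_one]
  | succ k =>
    have h : (descPochhammer ℝ (k + 1)).coeff 1 = (-1 : ℝ) ^ k * (k.factorial : ℝ) := by
      rw [descPochhammer_succ_left, Polynomial.coeff_X_mul, Polynomial.coeff_zero_eq_eval_zero,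
        Polynomial.eval_comp]
      have := ascPochhammer_eval_neg_eq_descPochhammer (R := ℝ) (-1) k
      rw [neg_neg, ascPochhammer_eval_one] at this
      rw [this, ← mul_assoc, ← mul_pow]
      simp
    have hk : (k.factorial : ℝ) ≠ 0 := by positivity
    rw [h, Nat.factorial_succ]
    push_cast
    field_simp

section Counting

open scoped Classical

/-- The number of maps `α → Fin x` whose kernel relation satisfies `C`. -/
noncomputable def mapCount {α : Type*} [Fintype α] (C : (α → α → Prop) → Prop) (x : ℕ) : ℕ :=
  #{f : α → Fin x | C fun i j => f i = f j}

/-- The number of surjections `α → Fin p` whose kernel relation satisfies `C`. -/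
noncomputable def surjCount {α : Type*} [Fintype α] (C : (α → α → Prop) → Prop) (p : ℕ) : ℕ :=
  #{f : α → Fin p | Function.Surjective f ∧ C fun i j => f i = f j}

variable {α : Type*} [Fintype α] (C : (α → α → Prop) → Prop)

lemma surjCount_eq_zero {p : ℕ} (hp : Fintype.card α < p) : surjCount C p = 0 := by
  rw [surjCount, Finset.card_eq_zero, Finset.filter_eq_empty_iff]
  rintro f - ⟨hf, -⟩
  have := Fintype.card_le_of_surjective f hf
  rw [Fintype.card_fin] at this
  omega

lemma surjCount_zero [Nonempty α] : surjCount C 0 = 0 := by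
  rw [surjCount, Finset.card_eq_zero, Finset.filter_eq_empty_iff]
  intro f
  exact (f (Classical.arbitrary α)).elim0

lemma card_filter_image_eq {x : ℕ} (S : Finset (Fin x)) :
    #{f : α → Fin x | (C fun i j => f i = f j) ∧ univ.image f = S} = surjCount C #S := by
  symm
  let e := S.equivFin.symm
  refine Finset.card_bij (fun g _ i => (e (g i) : Fin x)) ?_ ?_ ?_
  · intro g hg
    rw [Finset.mem_filter] at hg ⊢
    refine ⟨Finset.mem_univ _, ?_, ?_⟩
    · simpa [Subtype.coe_inj] using hg.2.2
    · ext a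
      simp only [Finset.mem_image, Finset.mem_univ, true_and]
      constructor
      · rintro ⟨i, rfl⟩
        exact (e (g i)).2
      · intro ha
        obtain ⟨i, hi⟩ := hg.2.1 (e.symm ⟨a, ha⟩)
        exact ⟨i, by simp [hi]⟩
  · intro g _ g' _ h
    funext i
    have := congrFun h i
    exact e.injective (Subtype.ext this)
  · intro f hf
    rw [Finset.mem_filter] at hf
    obtain ⟨-, hC, hS⟩ := hf
    have hmem : ∀ i, f i ∈ S := fun i => hS ▸ Finset.mem_image_of_mem f (Finset.mem_univ i)
    refine ⟨fun i => e.symm ⟨f i, hmem i⟩, ?_, ?_⟩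
    · rw [Finset.mem_filter]
      refine ⟨Finset.mem_univ _, ?_, ?_⟩
      · intro c
        have hc : (e c : Fin x) ∈ univ.image f := by
          rw [hS]
          exact (e c).2
        obtain ⟨i, -, hi⟩ := Finset.mem_image.1 hc
        exact ⟨i, by simp [hi]⟩
      · simpa using hC
    · funext i
      simp

lemma mapCount_eq_sum (x : ℕ) :
    mapCount C x = ∑ p ∈ range (Fintype.card α + 1), x.choose p * surjCount C p := by
  have h1 : mapCount C x = ∑ p ∈ range (x + 1), x.choose p * surjCount C p := by
    have := Finset.card_eq_sum_card_fiberwise (f := fun f : α → Fin x => univ.image f)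
      (s := {f : α → Fin x | C fun i j => f i = f j}) (t := (univ : Finset (Fin x)).powerset)
      (by intro f _; simp)
    rw [mapCount, this]
    simp only [Finset.filter_filter, card_filter_image_eq]
    rw [Finset.sum_powerset_apply_card]
    simp
  have key : ∀ a b : ℕ, (∀ p, a ≤ p → x.choose p * surjCount C p = 0) → a ≤ b →
      ∑ p ∈ range a, x.choose p * surjCount C p = ∑ p ∈ range b, x.choose p * surjCount C p := by
    intro a b h hab
    refine Finset.sum_subset (by simpa using hab) fun p _ hp => h p (by simpa using hp)
  have h0 : ∀ p, x + 1 ≤ p → x.choose p * surjCount C p = 0 := fun p hp => by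
    rw [Nat.choose_eq_zero_of_lt hp, zero_mul]
  have h0' : ∀ p, Fintype.card α + 1 ≤ p → x.choose p * surjCount C p = 0 := fun p hp => by
    rw [surjCount_eq_zero C hp, mul_zero]
  rw [h1, key _ _ h0 (le_max_left _ (Fintype.card α + 1)), key _ _ h0' (le_max_right (x + 1) _)]

/-- The polynomial whose value at each natural number `x` is `mapCount C x`. -/
noncomputable def countPoly : Polynomial ℝ :=
  ∑ p ∈ range (Fintype.card α + 1),
    Polynomial.C ((surjCount C p : ℝ) / (p.factorial : ℝ)) * descPochhammer ℝ p

lemma eval_countPoly (x : ℕ) : (countPoly C).eval (x : ℝ) = mapCount C x := by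
  rw [countPoly, Polynomial.eval_finsetSum, mapCount_eq_sum]
  push_cast
  refine Finset.sum_congr rfl fun p _ => ?_
  rw [Nat.cast_choose_eq_descPochhammer_div]
  simp
  ring

lemma coeff_zero_countPoly [Nonempty α] : (countPoly C).coeff 0 = 0 := by
  rw [countPoly, Polynomial.finsetSum_coeff]
  refine Finset.sum_eq_zero fun p _ => ?_
  rw [Polynomial.coeff_C_mul, Polynomial.coeff_zero_eq_eval_zero, descPochhammer_eval_zero]
  split_ifs with h
  · subst h
    simp [surjCount_zero]
  · simp

lemma coeff_one_countPoly : (countPoly C).coeff 1 =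
    ∑ p ∈ range (Fintype.card α + 1), (surjCount C p : ℝ) * ((-1 : ℝ) ^ (p - 1) / (p : ℝ)) := by
  rw [countPoly, Polynomial.finsetSum_coeff]
  refine Finset.sum_congr rfl fun p _ => ?_
  rw [Polynomial.coeff_C_mul, ← coeff_one_descPochhammer]
  ring

/-- If the counting function is a product of two counting functions on nonempty types, then the
signed count of surjections vanishes. -/
lemma sum_surjCount_eq_zero {β γ : Type*} [Fintype β] [Fintype γ] [Nonempty β] [Nonempty γ]
    (B : (β → β → Prop) → Prop) (D : (γ → γ → Prop) → Prop)
    (h : ∀ x, mapCount C x = mapCount B x * mapCount D x) :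
    ∑ p ∈ range (Fintype.card α + 1), (surjCount C p : ℝ) * ((-1 : ℝ) ^ (p - 1) / (p : ℝ)) = 0 := by
  have hP : countPoly C = countPoly B * countPoly D := by
    refine Polynomial.eq_of_infinite_eval_eq _ _
      ((Set.infinite_range_of_injective (Nat.cast_injective (R := ℝ))).mono ?_)
    rintro _ ⟨x, rfl⟩
    simp [eval_countPoly, h]
  rw [← coeff_one_countPoly, hP, Polynomial.mul_coeff_one, coeff_zero_countPoly,
    coeff_zero_countPoly]
  simp

/-- If `E` is a nonempty proper subset closed under `e`, the signed count of surjections whose kernel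
meets `e` in `t` vanishes. -/
lemma sum_surjCount_inf_eq_zero (e t : α → α → Prop) (E : Finset α) (hE : E.Nonempty)
    (hE' : ∃ i, i ∉ E) (he : ∀ i j, e i j → (i ∈ E ↔ j ∈ E)) :
    ∑ p ∈ range (Fintype.card α + 1),
      (surjCount (fun r : α → α → Prop => ∀ i j, (r i j ∧ e i j) ↔ t i j) p : ℝ) *
        ((-1 : ℝ) ^ (p - 1) / (p : ℝ)) = 0 := by
  have : Nonempty {i // i ∈ E} := hE.to_subtype
  have : Nonempty {i // i ∉ E} := hE'.elim fun i hi => ⟨⟨i, hi⟩⟩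
  refine sum_surjCount_eq_zero _
    (fun r : {i // i ∈ E} → {i // i ∈ E} → Prop =>
      (∀ i j, (r i j ∧ e i j) ↔ t i j) ∧ ∀ i j, t i j → (i ∈ E ↔ j ∈ E))
    (fun r : {i // i ∉ E} → {i // i ∉ E} → Prop => ∀ i j, (r i j ∧ e i j) ↔ t i j) ?_
  intro x
  rw [mapCount, mapCount, mapCount, ← Finset.card_product]
  refine Finset.card_equiv (Equiv.piEquivPiSubtypeProd (fun i => i ∈ E) fun _ => Fin x) ?_
  intro f
  simp only [Finset.mem_filter, Finset.mem_univ, true_and, Finset.mem_product,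
    Equiv.piEquivPiSubtypeProd_apply]
  constructor
  · intro h
    exact ⟨⟨fun i j => h i j, fun i j hij => he i j ((h i j).2 hij).2⟩, fun i j => h i j⟩
  · rintro ⟨⟨h1, h2⟩, h3⟩ i j
    by_cases hi : i ∈ E <;> by_cases hj : j ∈ E
    · exact h1 ⟨i, hi⟩ ⟨j, hj⟩
    · exact ⟨fun h => absurd ((he i j h.2).1 hi) hj, fun h => absurd ((h2 i j h).1 hi) hj⟩
    · exact ⟨fun h => absurd ((he i j h.2).2 hj) hi, fun h => absurd ((h2 i j h).2 hj) hi⟩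
    · exact h3 ⟨i, hi⟩ ⟨j, hj⟩

end Counting

section OrderedSetPartitions

variable {n : ℕ}

/-- The elements `i` and `j` lie in a common block of `π`. -/
def SameBlock (π : List (Block n)) (i j : Fin n) : Prop := ∃ P ∈ π, i ∈ P ∧ j ∈ P

lemma mem_unionList {l : List (Block n)} {i : Fin n} : i ∈ unionList l ↔ ∃ P ∈ l, i ∈ P := by
  induction l with
  | nil => simp [unionList]
  | cons P l ih =>
    have : unionList (P :: l) = P ∪ unionList l := rfl
    simp [this, ih]

lemma mem_restrict {σ : List (Block n)} {P Q : Block n} :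
    Q ∈ restrict σ P ↔ (∃ R ∈ σ, R ∩ P = Q) ∧ Q ≠ ∅ := by
  simp [restrict]

lemma restrict_append (l l' : List (Block n)) (P : Block n) :
    restrict (l ++ l') P = restrict l P ++ restrict l' P := by
  simp [restrict]

lemma restrict_eq_nil {l : List (Block n)} {P : Block n} (h : ∀ Q ∈ l, Disjoint Q P) :
    restrict l P = [] := by
  rw [List.eq_nil_iff_forall_not_mem]
  intro Q hQ
  obtain ⟨⟨R, hR, rfl⟩, hne⟩ := mem_restrict.1 hQ
  exact hne (Finset.disjoint_iff_inter_eq_empty.1 (h R hR))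

lemma restrict_eq_self {l : List (Block n)} {P : Block n} (hl : ∀ Q ∈ l, Q.Nonempty)
    (h : ∀ Q ∈ l, Q ⊆ P) : restrict l P = l := by
  have h1 : l.map (fun Q => Q ∩ P) = l := by
    conv_rhs => rw [← List.map_id l]
    exact List.map_congr_left fun Q hQ => Finset.inter_eq_left.2 (h Q hQ)
  rw [restrict, h1, List.filter_eq_self]
  intro Q hQ
  simpa [Finset.nonempty_iff_ne_empty] using hl Q hQ

lemma qmeet_cons (P : Block n) (σ π : List (Block n)) :
    qmeet (P :: σ) π = restrict π P ++ qmeet σ π := rfl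

lemma mem_qmeet {σ π : List (Block n)} {Q : Block n} :
    Q ∈ qmeet σ π ↔ (∃ P ∈ σ, ∃ R ∈ π, R ∩ P = Q) ∧ Q ≠ ∅ := by
  simp only [qmeet, List.mem_flatten, List.mem_map]
  constructor
  · rintro ⟨_, ⟨P, hP, rfl⟩, hQ⟩
    obtain ⟨hR, hQ⟩ := mem_restrict.1 hQ
    exact ⟨⟨P, hP, hR⟩, hQ⟩
  · rintro ⟨⟨P, hP, hR⟩, hQ⟩
    exact ⟨_, ⟨P, hP, rfl⟩, mem_restrict.2 ⟨hR, hQ⟩⟩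

lemma qmeet_perm {σ σ' : List (Block n)} (h : σ.Perm σ') (π : List (Block n)) :
    (qmeet σ π).Perm (qmeet σ' π) :=
  (h.map _).flatten

lemma sameBlock_qmeet {σ π : List (Block n)} {i j : Fin n} :
    SameBlock (qmeet σ π) i j ↔ ∃ P ∈ σ, ∃ R ∈ π, (i ∈ P ∧ j ∈ P) ∧ (i ∈ R ∧ j ∈ R) := by
  constructor
  · rintro ⟨Q, hQ, hi, hj⟩
    obtain ⟨⟨P, hP, R, hR, rfl⟩, -⟩ := mem_qmeet.1 hQ
    rw [Finset.mem_inter] at hi hj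
    exact ⟨P, hP, R, hR, ⟨hi.2, hj.2⟩, hi.1, hj.1⟩
  · rintro ⟨P, hP, R, hR, ⟨hiP, hjP⟩, hiR, hjR⟩
    have hi : i ∈ R ∩ P := Finset.mem_inter.2 ⟨hiR, hiP⟩
    exact ⟨R ∩ P, mem_qmeet.2 ⟨⟨P, hP, R, hR, rfl⟩, Finset.ne_empty_of_mem hi⟩, hi,
      Finset.mem_inter.2 ⟨hjR, hjP⟩⟩

lemma sameBlock_qmeet_iff {σ π : List (Block n)} {i j : Fin n} :
    SameBlock (qmeet σ π) i j ↔ SameBlock σ i j ∧ SameBlock π i j := by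
  rw [sameBlock_qmeet]
  constructor
  · rintro ⟨P, hP, R, hR, h1, h2⟩
    exact ⟨⟨P, hP, h1⟩, R, hR, h2⟩
  · rintro ⟨⟨P, hP, h1⟩, R, hR, h2⟩
    exact ⟨P, hP, R, hR, h1, h2⟩

namespace IsOSP

variable {E : Finset (Fin n)} {σ π : List (Block n)}

lemma nodup (h : IsOSP E σ) : σ.Nodup := by
  refine List.Pairwise.imp_of_mem ?_ h.2.1
  rintro P Q hP - hd rfl
  exact (h.1 P hP).ne_empty (disjoint_self.1 hd)

lemma of_perm (h : IsOSP E σ) (hp : σ.Perm π) : IsOSP E π := by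
  refine ⟨fun P hP => h.1 P (hp.mem_iff.2 hP), ?_, fun P hP => h.2.2.1 P (hp.mem_iff.2 hP), ?_⟩
  · exact (hp.pairwise_iff fun {_ _} hd => hd.symm).1 h.2.1
  · intro i hi
    obtain ⟨P, hP, hiP⟩ := h.2.2.2 i hi
    exact ⟨P, hp.mem_iff.1 hP, hiP⟩

lemma eq_of_mem (h : IsOSP E σ) {P Q : Block n} (hP : P ∈ σ) (hQ : Q ∈ σ) {i : Fin n}
    (hiP : i ∈ P) (hiQ : i ∈ Q) : P = Q := by
  by_contra hne
  have hsymm : Std.Symm (fun P Q : Block n => Disjoint P Q) := ⟨fun _ _ hd => hd.symm⟩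
  exact Finset.disjoint_left.1 (h.2.1.forall hP hQ hne) hiP hiQ

lemma perm_iff (hσ : IsOSP univ σ) (hπ : IsOSP univ π) :
    σ.Perm π ↔ ∀ i j, SameBlock σ i j ↔ SameBlock π i j := by
  constructor
  · intro h i j
    simp [SameBlock, h.mem_iff]
  · intro h
    have key : ∀ {σ π : List (Block n)}, IsOSP univ σ → IsOSP univ π →
        (∀ i j, SameBlock σ i j ↔ SameBlock π i j) → ∀ P ∈ σ, P ∈ π := by
      intro σ π hσ hπ h P hP
      obtain ⟨i, hi⟩ := hσ.1 P hP
      obtain ⟨Q, hQ, hiQ⟩ := hπ.2.2.2 i (Finset.mem_univ i)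
      have : P = Q := by
        ext j
        constructor
        · intro hj
          obtain ⟨Q', hQ', hi', hj'⟩ := (h i j).1 ⟨P, hP, hi, hj⟩
          rwa [hπ.eq_of_mem hQ hQ' hiQ hi']
        · intro hj
          obtain ⟨P', hP', hi', hj'⟩ := (h i j).2 ⟨Q, hQ, hiQ, hj⟩
          rwa [hσ.eq_of_mem hP hP' hi hi']
      rwa [this]
    rw [List.perm_ext_iff_of_nodup hσ.nodup hπ.nodup]
    exact fun P => ⟨key hσ hπ h P, key hπ hσ (fun i j => (h i j).symm) P⟩

lemma qmeet (hσ : IsOSP univ σ) (hπ : IsOSP univ π) : IsOSP univ (qmeet σ π) := by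
  refine ⟨?_, ?_, fun P _ => Finset.subset_univ P, ?_⟩
  · intro P hP
    exact Finset.nonempty_iff_ne_empty.2 (mem_qmeet.1 hP).2
  · rw [OSPpaper.qmeet, List.pairwise_flatten]
    constructor
    · intro l hl
      obtain ⟨P, -, rfl⟩ := List.mem_map.1 hl
      refine List.Pairwise.filter _ (List.pairwise_map.2 (hπ.2.1.imp ?_))
      intro Q R hd
      exact hd.mono Finset.inter_subset_left Finset.inter_subset_left
    · rw [List.pairwise_map]
      refine hσ.2.1.imp ?_
      intro P Q hd A hA B hB
      obtain ⟨⟨R, -, rfl⟩, -⟩ := mem_restrict.1 hA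
      obtain ⟨⟨S, -, rfl⟩, -⟩ := mem_restrict.1 hB
      exact hd.mono Finset.inter_subset_right Finset.inter_subset_right
  · intro i _
    obtain ⟨P, hP, hiP⟩ := hσ.2.2.2 i (Finset.mem_univ i)
    obtain ⟨R, hR, hiR⟩ := hπ.2.2.2 i (Finset.mem_univ i)
    have hi : i ∈ R ∩ P := Finset.mem_inter.2 ⟨hiR, hiP⟩
    exact ⟨_, mem_qmeet.2 ⟨⟨P, hP, R, hR, rfl⟩, Finset.ne_empty_of_mem hi⟩, hi⟩

lemma length_le (h : IsOSP univ σ) : σ.length ≤ n := by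
  choose r hr using fun c : Fin σ.length => h.1 _ (List.get_mem σ c)
  have hinj : Function.Injective r := fun c d hcd =>
    h.nodup.injective_get (h.eq_of_mem (List.get_mem _ _) (List.get_mem _ _) (hr c) (hcd ▸ hr d))
  simpa using Fintype.card_le_of_injective r hinj

lemma restrict_univ (h : IsOSP univ σ) : restrict σ univ = σ :=
  restrict_eq_self h.1 fun Q _ => Finset.subset_univ Q

end IsOSP

lemma restrict_restrict (σ : List (Block n)) (P Q : Block n) :
    restrict (restrict σ P) Q = restrict σ (P ∩ Q) := by
  induction σ with
  | nil => rfl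
  | cons R σ ih =>
    have h1 : ∀ (R : Block n) (l : List (Block n)) (P : Block n),
        restrict (R :: l) P = restrict [R] P ++ restrict l P := fun R l P =>
      restrict_append [R] l P
    rw [h1 R σ P, h1 R σ (P ∩ Q), restrict_append, ih]
    congr 1
    by_cases hP : R ∩ P = ∅
    · have hPQ : R ∩ (P ∩ Q) = ∅ := by rw [← Finset.inter_assoc, hP, Finset.empty_inter]
      simp [restrict, hP, hPQ]
    · simp [restrict, hP, Finset.inter_assoc]

lemma restrict_qmeet_eq_nil {σ : List (Block n)} (π : List (Block n)) {P : Block n}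
    (h : ∀ Q ∈ σ, Disjoint Q P) : restrict (qmeet σ π) P = [] := by
  refine restrict_eq_nil fun A hA => ?_
  obtain ⟨⟨Q, hQ, R, -, rfl⟩, -⟩ := mem_qmeet.1 hA
  exact (h Q hQ).mono_left Finset.inter_subset_right

lemma restrict_qmeet {σ : List (Block n)} (π : List (Block n)) {P : Block n}
    (hσ : σ.Pairwise fun P Q => Disjoint P Q) (hP : P ∈ σ) :
    restrict (qmeet σ π) P = restrict π P := by
  induction σ with
  | nil => simp at hP
  | cons Q σ ih =>
    rw [List.pairwise_cons] at hσ
    rw [qmeet_cons, restrict_append, restrict_restrict]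
    rcases List.mem_cons.1 hP with rfl | hP
    · rw [Finset.inter_self, restrict_qmeet_eq_nil π fun R hR => (hσ.1 R hR).symm, List.append_nil]
    · rw [ih hσ.2 hP, Finset.disjoint_iff_inter_eq_empty.1 (hσ.1 P hP),
        restrict_eq_nil fun R _ => Finset.disjoint_empty_right R, List.nil_append]

lemma qmeet_qmeet_of_perm {σ σ' : List (Block n)} (π : List (Block n))
    (hσ' : σ'.Pairwise fun P Q => Disjoint P Q) (h : σ.Perm σ') :
    qmeet σ (qmeet σ' π) = qmeet σ π := by
  rw [qmeet, qmeet]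
  congr 1
  exact List.map_congr_left fun P hP => restrict_qmeet π hσ' (h.mem_iff.1 hP)

lemma restrict_flatten_unionList {L : List (List (Block n))}
    (hne : ∀ P ∈ L.flatten, P.Nonempty) (hd : L.flatten.Pairwise fun P Q => Disjoint P Q)
    {l : List (Block n)} (hl : l ∈ L) : restrict L.flatten (unionList l) = l := by
  induction L with
  | nil => simp at hl
  | cons l₀ L ih =>
    rw [List.flatten_cons] at hne hd ⊢
    rw [List.pairwise_append] at hd
    rw [restrict_append]
    rcases List.mem_cons.1 hl with rfl | hl
    · rw [restrict_eq_self (fun Q hQ => hne Q (List.mem_append_left _ hQ))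
        (fun Q hQ i hi => mem_unionList.2 ⟨Q, hQ, hi⟩), restrict_eq_nil, List.append_nil]
      intro Q hQ
      rw [Finset.disjoint_left]
      intro i hi hi'
      obtain ⟨P, hP, hiP⟩ := mem_unionList.1 hi'
      exact Finset.disjoint_left.1 (hd.2.2 P hP Q hQ) hiP hi
    · rw [ih (fun Q hQ => hne Q (List.mem_append_right _ hQ)) hd.2.1 hl, restrict_eq_nil,
        List.nil_append]
      intro Q hQ
      rw [Finset.disjoint_left]
      intro i hi hi'
      obtain ⟨P, hP, hiP⟩ := mem_unionList.1 hi'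
      exact Finset.disjoint_left.1
        (hd.2.2 Q hQ P (List.mem_flatten.2 ⟨l, hl, hP⟩)) hi hiP

lemma ospLe_iff_qmeet_eq {π σ : List (Block n)} (hπ : IsOSP univ π) :
    OSPle π σ ↔ qmeet σ π = π := by
  constructor
  · rintro ⟨L, rfl, rfl⟩
    rw [qmeet, List.map_map]
    congr 1
    conv_rhs => rw [← List.map_id L]
    exact List.map_congr_left fun l hl => restrict_flatten_unionList hπ.1 hπ.2.1 hl
  · intro h
    refine ⟨σ.map (restrict π), h, ?_⟩
    rw [List.map_map]
    conv_lhs => rw [← List.map_id σ]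
    refine List.map_congr_left fun P _ => ?_
    ext i
    simp only [id_eq, Function.comp_apply, mem_unionList]
    constructor
    · intro hi
      obtain ⟨R, hR, hiR⟩ := hπ.2.2.2 i (Finset.mem_univ i)
      have hi' : i ∈ R ∩ P := Finset.mem_inter.2 ⟨hiR, hi⟩
      exact ⟨R ∩ P, mem_restrict.2 ⟨⟨R, hR, rfl⟩, Finset.ne_empty_of_mem hi'⟩, hi'⟩
    · rintro ⟨Q, hQ, hiQ⟩
      obtain ⟨⟨R, -, rfl⟩, -⟩ := mem_restrict.1 hQ
      exact (Finset.mem_inter.1 hiQ).2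

end OrderedSetPartitions

section Coefficients

open scoped Classical

variable {n : ℕ}

/-- The finite set of all ordered set partitions of `[n]`. -/
noncomputable def allOSP (n : ℕ) : Finset (List (Block n)) :=
  ((List.finite_length_le (Block n) n).subset
    fun _ h => IsOSP.length_le h : {σ : List (Block n) | IsOSP univ σ}.Finite).toFinset

lemma mem_allOSP {σ : List (Block n)} : σ ∈ allOSP n ↔ IsOSP univ σ := by
  simp [allOSP]

lemma finsum_eq_sum_allOSP (p : List (Block n) → Prop) [DecidablePred p]
    (F : List (Block n) → ℝ) :
    ∑ᶠ σ ∈ {σ : List (Block n) | IsOSP univ σ ∧ p σ}, F σ = ∑ σ ∈ allOSP n with p σ, F σ := by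
  rw [← finsum_mem_coe_finset]
  simp [mem_allOSP]

lemma wcoef_eq_sum (τ η : List (Block n)) :
    wcoef τ η = ∑ σ ∈ allOSP n with qmeet σ η = τ, muR σ [univ] :=
  finsum_eq_sum_allOSP _ _

lemma gcoef_eq_sum {τ : List (Block n)} (hτ : IsOSP univ τ) (η : List (Block n)) :
    gcoef τ η = ∑ σ ∈ allOSP n with qmeet σ τ = τ, zetaR τ σ * wcoef σ η := by
  rw [gcoef, finsum_eq_sum_allOSP]
  simp only [ospLe_iff_qmeet_eq hτ]

/-- Permuting the entries of a duplicate-free list hits each rearrangement exactly once. -/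
lemma sum_perm_eq_sum_filter {τ : List (Block n)} (hτ : IsOSP univ τ) (F : List (Block n) → ℝ) :
    ∑ h : Equiv.Perm (Fin τ.length), F (List.ofFn fun j => τ.get (h j)) =
      ∑ π ∈ allOSP n with π.Perm τ, F π := by
  have hperm : ∀ h : Equiv.Perm (Fin τ.length), (List.ofFn fun j => τ.get (h j)).Perm τ := by
    intro h
    have := Equiv.Perm.ofFn_comp_perm h τ.get
    rwa [List.ofFn_get] at this
  refine Finset.sum_bij (fun h _ => List.ofFn fun j => τ.get (h j)) ?_ ?_ ?_ fun _ _ => rfl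
  · intro h _
    rw [Finset.mem_filter, mem_allOSP]
    exact ⟨hτ.of_perm (hperm h).symm, hperm h⟩
  · intro h _ h' _ heq
    ext j
    have := congrFun (List.ofFn_injective heq) j
    rw [hτ.nodup.injective_get this]
  · intro π hπ
    rw [Finset.mem_filter, mem_allOSP] at hπ
    obtain ⟨hπ, hp⟩ := hπ
    have hlen : τ.length = π.length := hp.length_eq.symm
    let e : Fin τ.length ≃ Fin τ.length :=
      (finCongr hlen).trans ((hπ.nodup.getEquiv π).trans
        ((Equiv.subtypeEquivRight fun P => hp.mem_iff).trans (hτ.nodup.getEquiv τ).symm))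
    refine ⟨e, Finset.mem_univ _, ?_⟩
    have he : ∀ j : Fin τ.length, τ.get (e j) = π.get (Fin.cast hlen j) := by
      intro j
      exact congrArg Subtype.val ((hτ.nodup.getEquiv τ).apply_symm_apply
        ((Equiv.subtypeEquivRight fun P => hp.mem_iff) (hπ.nodup.getEquiv π (Fin.cast hlen j))))
    simp only [he]
    refine List.ext_get (by simpa using hlen) ?_
    intro i h1 h2
    simp

lemma muR_univ {σ : List (Block n)} (hσ : IsOSP univ σ) :
    muR σ [univ] = (-1 : ℝ) ^ (σ.length - 1) / (σ.length : ℝ) := by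
  simp [muR, colonNum, hσ.restrict_univ]

/-- The list of fibres of a map to `Fin p`. -/
def fibres {p : ℕ} (f : Fin n → Fin p) : List (Block n) :=
  List.ofFn fun c => univ.filter fun k => f k = c

lemma sameBlock_fibres {p : ℕ} (f : Fin n → Fin p) (i j : Fin n) :
    SameBlock (fibres f) i j ↔ f i = f j := by
  simp only [SameBlock, fibres, List.mem_ofFn]
  constructor
  · rintro ⟨_, ⟨c, rfl⟩, hi, hj⟩
    simp only [Finset.mem_filter, Finset.mem_univ, true_and] at hi hj
    rw [hi, hj]
  · intro h
    exact ⟨_, ⟨f j, rfl⟩, by simpa using h, by simp⟩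

lemma isOSP_fibres {p : ℕ} {f : Fin n → Fin p} (hf : Function.Surjective f) :
    IsOSP univ (fibres f) := by
  refine ⟨?_, ?_, fun P _ => Finset.subset_univ P, ?_⟩
  · intro P hP
    simp only [fibres, List.mem_ofFn] at hP
    obtain ⟨c, rfl⟩ := hP
    obtain ⟨k, hk⟩ := hf c
    exact ⟨k, by simpa using hk⟩
  · rw [fibres, List.pairwise_ofFn]
    intro c d hcd
    rw [Finset.disjoint_left]
    intro k hk hk'
    simp only [Finset.mem_filter, Finset.mem_univ, true_and] at hk hk'
    exact hcd.ne (hk.symm.trans hk')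
  · intro i _
    exact ⟨_, by rw [fibres, List.mem_ofFn]; exact ⟨f i, rfl⟩, by simp⟩

lemma fibres_injective {p : ℕ} : Function.Injective (fibres (n := n) (p := p)) := by
  intro f g h
  funext k
  have := congrFun (List.ofFn_injective h) (f k)
  have hk : k ∈ univ.filter fun k' => g k' = f k := by
    rw [← this]
    simp
  exact (Finset.mem_filter.1 hk).2.symm

lemma exists_fibres_eq {σ : List (Block n)} (hσ : IsOSP univ σ) :
    ∃ f : Fin n → Fin σ.length, Function.Surjective f ∧ fibres f = σ := by
  have h : ∀ k, ∃ c : Fin σ.length, k ∈ σ.get c := by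
    intro k
    obtain ⟨P, hP, hk⟩ := hσ.2.2.2 k (Finset.mem_univ k)
    obtain ⟨c, rfl⟩ := List.get_of_mem hP
    exact ⟨c, hk⟩
  choose f hf using h
  have huniq : ∀ k c, k ∈ σ.get c → f k = c := fun k c hk =>
    hσ.nodup.injective_get (hσ.eq_of_mem (List.get_mem _ _) (List.get_mem _ _) (hf k) hk)
  refine ⟨f, ?_, ?_⟩
  · intro c
    obtain ⟨k, hk⟩ := hσ.1 _ (List.get_mem σ c)
    exact ⟨k, huniq k c hk⟩
  · conv_rhs => rw [← List.ofFn_get σ]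
    rw [fibres]
    congr 1
    funext c
    ext k
    simp only [Finset.mem_filter, Finset.mem_univ, true_and]
    exact ⟨fun h => h ▸ hf k, huniq k c⟩

lemma card_filter_qmeet_perm {τ η : List (Block n)} (hτ : IsOSP univ τ) (hη : IsOSP univ η)
    (p : ℕ) :
    #{σ ∈ allOSP n | (qmeet σ η).Perm τ ∧ σ.length = p} =
      surjCount (fun r : Fin n → Fin n → Prop =>
        ∀ i j, (r i j ∧ SameBlock η i j) ↔ SameBlock τ i j) p := by
  symm
  refine Finset.card_bij (fun f _ => fibres f) ?_ (fun f _ g _ h => fibres_injective h) ?_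
  · intro f hf
    simp only [Finset.mem_filter, Finset.mem_univ, true_and] at hf
    rw [Finset.mem_filter, mem_allOSP]
    have ho := isOSP_fibres hf.1
    refine ⟨ho, ?_, by simp [fibres]⟩
    rw [(ho.qmeet hη).perm_iff hτ]
    simpa only [sameBlock_qmeet_iff, sameBlock_fibres] using hf.2
  · intro σ hσ
    rw [Finset.mem_filter, mem_allOSP] at hσ
    obtain ⟨ho, hp, rfl⟩ := hσ
    obtain ⟨f, hf, hfσ⟩ := exists_fibres_eq ho
    refine ⟨f, ?_, hfσ⟩
    simp only [Finset.mem_filter, Finset.mem_univ, true_and]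
    rw [(ho.qmeet hη).perm_iff hτ] at hp
    refine ⟨hf, fun i j => ?_⟩
    rw [← hp i j, sameBlock_qmeet_iff, ← sameBlock_fibres f, hfσ]

/-- The Weisner coefficients of all rearrangements of `τ` sum to zero. -/
lemma sum_wcoef_perm_eq_zero {τ η : List (Block n)} (hτ : IsOSP univ τ) (hη : IsOSP univ η)
    (hη2 : 2 ≤ η.length) : ∑ π ∈ allOSP n with π.Perm τ, wcoef π η = 0 := by
  have h1 : ∑ π ∈ allOSP n with π.Perm τ, wcoef π η =
      ∑ σ ∈ allOSP n with (qmeet σ η).Perm τ, muR σ [univ] := by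
    rw [← Finset.sum_fiberwise_of_maps_to (s := {σ ∈ allOSP n | (qmeet σ η).Perm τ})
      (t := {π ∈ allOSP n | π.Perm τ}) (g := fun σ => qmeet σ η)]
    · refine Finset.sum_congr rfl fun π hπ => ?_
      rw [wcoef_eq_sum, Finset.filter_filter]
      refine Finset.sum_congr (Finset.filter_congr fun σ _ => ?_) fun _ _ => rfl
      exact ⟨fun h => ⟨h ▸ (Finset.mem_filter.1 hπ).2, h⟩, fun h => h.2⟩
    · intro σ hσ
      rw [Finset.mem_filter, mem_allOSP] at hσ ⊢
      exact ⟨hσ.1.qmeet hη, hσ.2⟩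
  rw [h1, ← Finset.sum_fiberwise_of_maps_to (t := range (n + 1)) (g := List.length)]
  · obtain ⟨P, Q, l, rfl⟩ : ∃ P Q l, η = P :: Q :: l := by
      match η, hη2 with
      | P :: Q :: l, _ => exact ⟨P, Q, l, rfl⟩
    have hPQ : Disjoint P Q := (List.pairwise_cons.1 hη.2.1).1 Q (by simp)
    obtain ⟨q, hq⟩ := hη.1 Q (by simp)
    have := sum_surjCount_inf_eq_zero (SameBlock (P :: Q :: l)) (SameBlock τ) P
      (hη.1 P (by simp)) ⟨q, fun h => Finset.disjoint_left.1 hPQ h hq⟩ (by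
        rintro i j ⟨R, hR, hi, hj⟩
        constructor
        · intro h
          rwa [hη.eq_of_mem (P := P) (by simp) hR h hi]
        · intro h
          rwa [hη.eq_of_mem (P := P) (by simp) hR h hj])
    rw [Fintype.card_fin] at this
    rw [← this]
    refine Finset.sum_congr rfl fun p _ => ?_
    rw [← card_filter_qmeet_perm hτ hη, ← nsmul_eq_mul, ← Finset.sum_const, Finset.filter_filter]
    refine Finset.sum_congr rfl fun σ hσ => ?_
    rw [Finset.mem_filter, mem_allOSP] at hσ
    rw [muR_univ hσ.1, hσ.2.2]
  · intro σ hσ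
    rw [Finset.mem_filter, mem_allOSP] at hσ
    have := hσ.1.length_le
    rw [Finset.mem_range]
    omega

lemma zetaR_qmeet {σ σ' : List (Block n)} (π : List (Block n)) (h : σ.Perm σ')
    (hσ' : σ'.Pairwise fun P Q => Disjoint P Q) : zetaR (qmeet σ' π) σ' = zetaR π σ := by
  have h1 : colonFac (qmeet σ' π) σ' = colonFac π σ' := by
    rw [colonFac, colonFac]
    congr 1
    exact List.map_congr_left fun P hP => by rw [restrict_qmeet π hσ' hP]
  rw [zetaR, zetaR, h1, colonFac, colonFac, (h.map _).prod_eq]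

/-- The total `ζ̃`-weight of the rearrangements of `τ` below `σ` does not depend on the order of the
blocks of `σ`. -/
lemma sum_zetaR_eq_of_perm {σ σ' : List (Block n)} (τ : List (Block n)) (hσ : IsOSP univ σ)
    (h : σ.Perm σ') :
    ∑ π ∈ allOSP n with π.Perm τ ∧ qmeet σ π = π, zetaR π σ =
      ∑ π ∈ allOSP n with π.Perm τ ∧ qmeet σ' π = π, zetaR π σ' := by
  have hσ' := hσ.of_perm h
  have hmem : ∀ {σ σ' : List (Block n)}, IsOSP univ σ' → σ.Perm σ' →
      ∀ π ∈ {π ∈ allOSP n | π.Perm τ ∧ qmeet σ π = π},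
        qmeet σ' π ∈ {π ∈ allOSP n | π.Perm τ ∧ qmeet σ' π = π} := by
    intro σ σ' hσ' h π hπ
    rw [Finset.mem_filter, mem_allOSP] at hπ ⊢
    refine ⟨hσ'.qmeet hπ.1, ?_, qmeet_qmeet_of_perm π hσ'.2.1 (List.Perm.refl _)⟩
    have := qmeet_perm h.symm π
    rw [hπ.2.2] at this
    exact this.trans hπ.2.1
  refine Finset.sum_nbij' (fun π => qmeet σ' π) (fun π => qmeet σ π) (hmem hσ' h)
    (hmem hσ h.symm) ?_ ?_ ?_
  · intro π hπ
    rw [qmeet_qmeet_of_perm π hσ'.2.1 h]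
    exact (Finset.mem_filter.1 hπ).2.2
  · intro π hπ
    rw [qmeet_qmeet_of_perm π hσ.2.1 h.symm]
    exact (Finset.mem_filter.1 hπ).2.2
  · intro π _
    exact (zetaR_qmeet π h hσ'.2.1).symm

/-- A sum of Weisner coefficients against a weight invariant under rearrangement vanishes. -/
lemma sum_mul_wcoef_eq_zero {η : List (Block n)} (hη : IsOSP univ η) (hη2 : 2 ≤ η.length)
    (c : List (Block n) → ℝ) (hc : ∀ σ σ', IsOSP univ σ → σ.Perm σ' → c σ = c σ') :
    ∑ σ ∈ allOSP n, c σ * wcoef σ η = 0 := by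
  rw [← Finset.sum_fiberwise_of_maps_to (t := (allOSP n).image Multiset.ofList)
    (g := Multiset.ofList) fun σ hσ => Finset.mem_image_of_mem _ hσ]
  refine Finset.sum_eq_zero fun m hm => ?_
  obtain ⟨τ, hτ, rfl⟩ := Finset.mem_image.1 hm
  rw [mem_allOSP] at hτ
  simp only [Multiset.coe_eq_coe]
  calc ∑ σ ∈ allOSP n with σ.Perm τ, c σ * wcoef σ η
      = ∑ σ ∈ allOSP n with σ.Perm τ, c τ * wcoef σ η := by
        refine Finset.sum_congr rfl fun σ hσ => ?_
        rw [Finset.mem_filter, mem_allOSP] at hσ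
        rw [hc σ τ hσ.1 hσ.2]
    _ = 0 := by rw [← Finset.mul_sum, sum_wcoef_perm_eq_zero hτ hη hη2, mul_zero]

/-- The Goldberg coefficients of all rearrangements of `τ` sum to zero. -/
lemma sum_gcoef_perm_eq_zero (τ : List (Block n)) {η : List (Block n)} (hη : IsOSP univ η)
    (hη2 : 2 ≤ η.length) : ∑ π ∈ allOSP n with π.Perm τ, gcoef π η = 0 := by
  rw [← sum_mul_wcoef_eq_zero hη hη2 _ fun σ σ' hσ h => sum_zetaR_eq_of_perm τ hσ h]
  simp only [Finset.sum_mul]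
  rw [Finset.sum_comm' (t' := {π ∈ allOSP n | π.Perm τ})
    (s' := fun π => {σ ∈ allOSP n | qmeet σ π = π})]
  · refine Finset.sum_congr rfl fun π hπ => ?_
    rw [Finset.mem_filter, mem_allOSP] at hπ
    exact gcoef_eq_sum hπ.1 η
  · intro σ π
    simp only [Finset.mem_filter]
    tauto

end Coefficients

/-- Let `τ = (T₁,…,T_s), η ∈ OP_n` with `|η| ≥ 2`. Then
`∑_{h ∈ S_s} w(h(τ),η) = 0` and `∑_{h ∈ S_s} g(h(τ),η) = 0`, where `h(τ)` is the ordered set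
partition obtained by permuting the blocks of `τ` by `h`. -/
theorem statement17 {n : ℕ} (τ η : List (Block n))
    (hτ : IsOSP Finset.univ τ) (hη : IsOSP Finset.univ η) (hη2 : 2 ≤ η.length) :
    (∑ h : Equiv.Perm (Fin τ.length), wcoef (List.ofFn (fun j => τ.get (h j))) η) = 0 ∧
    (∑ h : Equiv.Perm (Fin τ.length), gcoef (List.ofFn (fun j => τ.get (h j))) η) = 0 := by
  rw [sum_perm_eq_sum_filter hτ fun π => wcoef π η,
    sum_perm_eq_sum_filter hτ fun π => gcoef π η]
  exact ⟨sum_wcoef_perm_eq_zero hτ hη hη2, sum_gcoef_perm_eq_zero τ hη hη2⟩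

end OSPpaper
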